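/- Let a < b be real numbers, let s = (a + b)/2 be the midpoint, and let f : ℝ → ℝ be continuously differentiable on [a, b]. Then ∫_a^b (f(t) − f(s))² dt ≤ ((b − a)²/π²) · ∫_a^b f′(t)² dt. -/

import Mathlib

open MeasureTheory intervalIntegral Real

/-- Weighted Wirtinger inequality: if `u ^ 2 * tan (k * (t - c))` vanishes at both endpoints and
`cos (k * (t - c))` does not vanish in between, then `k ^ 2 * ∫ u ^ 2 ≤ ∫ u' ^ 2`. -/
theorem sq_mul_integral_sq_le_of_tan_boundary
    {p q k c : ℝ} (hpq : p ≤ q) {u u' : ℝ → ℝ}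
    (hderiv : ∀ t ∈ Set.Icc p q, HasDerivAt u (u' t) t)
    (hcont : ContinuousOn u' (Set.Icc p q))
    (hcos : ∀ t ∈ Set.Icc p q, cos (k * (t - c)) ≠ 0)
    (hp : u p ^ 2 * tan (k * (p - c)) = 0) (hq : u q ^ 2 * tan (k * (q - c)) = 0) :
    k ^ 2 * ∫ t in p..q, u t ^ 2 ≤ ∫ t in p..q, u' t ^ 2 := by
  have hu : ContinuousOn u (Set.Icc p q) := fun t ht =>
    (hderiv t ht).continuousAt.continuousWithinAt
  have htan_deriv : ∀ t ∈ Set.Icc p q, HasDerivAt (fun t => tan (k * (t - c)))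
      (k * (1 + tan (k * (t - c)) ^ 2)) t := by
    intro t ht
    have hlin : HasDerivAt (fun t => k * (t - c)) k t := by
      simpa using ((hasDerivAt_id t).sub_const c).const_mul k
    refine ((hasDerivAt_tan (hcos t ht)).comp t hlin).congr_deriv ?_
    rw [← inv_one_add_tan_sq (hcos t ht)]
    simp [mul_comm]
  have htan : ContinuousOn (fun t => tan (k * (t - c))) (Set.Icc p q) := fun t ht =>
    (htan_deriv t ht).continuousAt.continuousWithinAt
  have hint : ∀ {g : ℝ → ℝ}, ContinuousOn g (Set.Icc p q) → IntervalIntegrable g volume p q :=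
    fun hg => hg.intervalIntegrable_of_Icc hpq
  set D : ℝ → ℝ := fun t => 2 * u t * u' t * tan (k * (t - c)) +
    u t ^ 2 * (k * (1 + tan (k * (t - c)) ^ 2)) with hD
  have hDcont : ContinuousOn D (Set.Icc p q) := by fun_prop
  have hD0 : ∫ t in p..q, D t = 0 := by
    rw [integral_eq_sub_of_hasDerivAt (f := fun t => u t ^ 2 * tan (k * (t - c))) _ (hint hDcont)]
    · simp only [hp, hq, sub_zero]
    · intro t ht
      rw [Set.uIcc_of_le hpq] at ht
      refine (((hderiv t ht).pow 2).mul (htan_deriv t ht)).congr_deriv ?_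
      simp [hD]
  have hnonneg : 0 ≤ ∫ t in p..q, (u' t ^ 2 - k ^ 2 * u t ^ 2 + k * D t) := by
    refine integral_nonneg hpq fun t _ => ?_
    have : u' t ^ 2 - k ^ 2 * u t ^ 2 + k * D t = (u' t + k * u t * tan (k * (t - c))) ^ 2 := by
      simp only [hD]; ring
    rw [this]
    positivity
  rw [integral_add (hint (by fun_prop)) (hint (by fun_prop)),
    integral_sub (hint (by fun_prop)) (hint (by fun_prop)),
    intervalIntegral.integral_const_mul, intervalIntegral.integral_const_mul, hD0] at hnonneg
  linarith

/-- Midpoint Wirtinger inequality: for `f` continuously differentiable on `[a, b]`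
and `s = (a+b)/2`, `∫ (f - f(s))² ≤ ((b-a)²/π²) ∫ f′²`. -/
theorem wirtinger_midpoint
    (a b : ℝ) (hab : a < b) (f f' : ℝ → ℝ)
    (hderiv : ∀ t ∈ Set.Icc a b, HasDerivAt f (f' t) t)
    (hcont : ContinuousOn f' (Set.Icc a b)) :
    ∫ t in a..b, (f t - f ((a + b) / 2)) ^ 2
      ≤ ((b - a) ^ 2 / π ^ 2) * ∫ t in a..b, (f' t) ^ 2 := by
  set s := (a + b) / 2 with hs
  have has : a ≤ s := by linarith
  have hsb : s ≤ b := by linarith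
  have hL : 0 < b - a := sub_pos.2 hab
  have hleft : Set.Icc a s ⊆ Set.Icc a b := Set.Icc_subset_Icc_right hsb
  have hright : Set.Icc s b ⊆ Set.Icc a b := Set.Icc_subset_Icc_left has
  have hu : ∀ t ∈ Set.Icc a b, HasDerivAt (fun t => f t - f s) (f' t) t := fun t ht =>
    (hderiv t ht).sub_const _
  have hu_sq : ContinuousOn (fun t => (f t - f s) ^ 2) (Set.Icc a b) := fun t ht =>
    ((hu t ht).continuousAt.pow 2).continuousWithinAt
  have hu'_sq : ContinuousOn (fun t => f' t ^ 2) (Set.Icc a b) := hcont.pow 2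
  have key : ∀ k ∈ Set.Ioo 0 (π / (b - a)),
      k ^ 2 * ∫ t in a..b, (f t - f s) ^ 2 ≤ ∫ t in a..b, f' t ^ 2 := by
    rintro k ⟨hk0, hk⟩
    rw [lt_div_iff₀ hL] at hk
    have h₁ := sq_mul_integral_sq_le_of_tan_boundary (k := k) (c := a) has
      (fun t ht => hu t (hleft ht)) (hcont.mono hleft)
      (fun t ht => (cos_pos_of_mem_Ioo
        ⟨by nlinarith [ht.1, pi_pos], by nlinarith [ht.2]⟩).ne') (by simp) (by simp)
    have h₂ := sq_mul_integral_sq_le_of_tan_boundary (k := k) (c := b) hsb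
      (fun t ht => hu t (hright ht)) (hcont.mono hright)
      (fun t ht => (cos_pos_of_mem_Ioo
        ⟨by nlinarith [ht.1], by nlinarith [ht.2, pi_pos]⟩).ne') (by simp) (by simp)
    rw [← integral_add_adjacent_intervals
        ((hu_sq.mono hleft).intervalIntegrable_of_Icc has)
        ((hu_sq.mono hright).intervalIntegrable_of_Icc hsb),
      ← integral_add_adjacent_intervals
        ((hu'_sq.mono hleft).intervalIntegrable_of_Icc has)
        ((hu'_sq.mono hright).intervalIntegrable_of_Icc hsb)]
    linarith
  have hlim : (π / (b - a)) ^ 2 * ∫ t in a..b, (f t - f s) ^ 2 ≤ ∫ t in a..b, f' t ^ 2 := by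
    have hmem : π / (b - a) ∈ closure (Set.Ioo 0 (π / (b - a))) := by
      have hpos : 0 < π / (b - a) := by positivity
      rw [closure_Ioo hpos.ne]
      exact Set.right_mem_Icc.2 hpos.le
    exact le_on_closure key (by fun_prop) (by fun_prop) hmem
  rw [div_pow, div_mul_eq_mul_div, div_le_iff₀ (by positivity)] at hlim
  rw [div_mul_eq_mul_div, le_div_iff₀ (by positivity)]
  linarith
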